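/- arXiv:1807.05824 — 2 statements merged into one kernel-verified Lean document; each statement's English description precedes it below -/
import Mathlib

section
/- Let 1 ≤ p ≤ ∞, ρ > 0, and let F : ℓ_{p,ρ}(ℤ;H) → ℓ_{p,ρ}(ℤ;H) be Lipschitz with Lipschitz constant strictly less than ρ, i.e. sup_{x≠y} |F(x)−F(y)|_{p,ρ}/|x−y|_{p,ρ} < ρ. Then the difference equation τu = F(u) has a unique solution u ∈ ℓ_{p,ρ}(ℤ;H). -/
open scoped ENNReal NNReal
open Function

noncomputable section

variable (H : Type*) [NormedAddCommGroup H] [InnerProductSpace ℂ H]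

/-- The weighting map `x ↦ (ρ^{-k} • x_k)_k`. -/
def wt (ρ : ℝ) (x : ℤ → H) : ℤ → H := fun k => ((ρ : ℂ) ^ (-k : ℤ)) • x k

variable {H}

theorem wt_add (ρ : ℝ) (x y : ℤ → H) : wt H ρ (x + y) = wt H ρ x + wt H ρ y := by
  funext k; simp [wt, smul_add]

theorem wt_smul (ρ : ℝ) (c : ℂ) (x : ℤ → H) : wt H ρ (c • x) = c • wt H ρ x := by
  funext k
  show ((ρ : ℂ) ^ (-k : ℤ)) • (c • x k) = c • (((ρ : ℂ) ^ (-k : ℤ)) • x k)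
  exact smul_comm _ _ _

variable (H)

/-- The exponentially weighted space `ℓ_{p,ρ}(ℤ; H)`, bundled as a submodule of `ℤ → H`:
a sequence `x` belongs to it iff `(ρ^{-k} • x_k)_k` is in `ℓ^p`. -/
def WSub (p : ℝ≥0∞) (ρ : ℝ) : Submodule ℂ (ℤ → H) where
  carrier := {x | Memℓp (wt H ρ x) p}
  add_mem' := fun {a b} ha hb => by
    simpa [Set.mem_setOf_eq, wt_add] using Memℓp.add ha hb
  zero_mem' := by
    have h : wt H ρ 0 = 0 := by funext k; simp [wt]
    simpa [Set.mem_setOf_eq, h] using zero_memℓp (E := fun _ : ℤ => H) (p := p)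
  smul_mem' := fun c x hx => by
    simpa [Set.mem_setOf_eq, wt_smul] using Memℓp.const_smul hx c

/-- The exponentially weighted sequence space `ℓ_{p,ρ}(ℤ; H)`. -/
def WLp (p : ℝ≥0∞) (ρ : ℝ) : Type _ := ↥(WSub H p ρ)

namespace WLp

variable {H} {p : ℝ≥0∞} {ρ : ℝ}

instance : AddCommGroup (WLp H p ρ) := inferInstanceAs (AddCommGroup ↥(WSub H p ρ))
instance : Module ℂ (WLp H p ρ) := inferInstanceAs (Module ℂ ↥(WSub H p ρ))

/-- Build an element of `ℓ_{p,ρ}(ℤ;H)` from a sequence. -/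
def mk (x : ℤ → H) (hx : Memℓp (wt H ρ x) p) : WLp H p ρ := ⟨x, hx⟩

/-- The underlying two-sided sequence. -/
instance : CoeFun (WLp H p ρ) (fun _ => ℤ → H) := ⟨Subtype.val⟩

@[simp] theorem coe_add (x y : WLp H p ρ) (k : ℤ) : (x + y) k = x k + y k := rfl
@[simp] theorem coe_smul (c : ℂ) (x : WLp H p ρ) (k : ℤ) : (c • x) k = c • x k := rfl
@[simp] theorem coe_mk (x : ℤ → H) (hx : Memℓp (wt H ρ x) p) (k : ℤ) : (mk x hx) k = x k := rfl

theorem ext {x y : WLp H p ρ} (h : ∀ k, x k = y k) : x = y := Subtype.ext (funext h)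

theorem memℓp (x : WLp H p ρ) : Memℓp (wt H ρ (x : ℤ → H)) p := x.2

/-- The canonical identification with the unweighted `lp` space, as a linear map. -/
def toLpₗ (H : Type*) [NormedAddCommGroup H] [InnerProductSpace ℂ H] (p : ℝ≥0∞) (ρ : ℝ) :
    WLp H p ρ →ₗ[ℂ] lp (fun _ : ℤ => H) p where
  toFun x := ⟨wt H ρ (x : ℤ → H), x.2⟩
  map_add' x y := by
    apply Subtype.ext
    show wt H ρ ((x : ℤ → H) + (y : ℤ → H)) = wt H ρ x + wt H ρ y
    exact wt_add ρ _ _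
  map_smul' c x := by
    apply Subtype.ext
    show wt H ρ (c • (x : ℤ → H)) = c • wt H ρ x
    exact wt_smul ρ c _

theorem toLp_injective (H : Type*) [NormedAddCommGroup H] [InnerProductSpace ℂ H]
    (p : ℝ≥0∞) (ρ : ℝ) [hρ : Fact (0 < ρ)] : Function.Injective (toLpₗ H p ρ) := by
  intro x y hxy
  have h : wt H ρ (x : ℤ → H) = wt H ρ (y : ℤ → H) := congrArg Subtype.val hxy
  apply Subtype.ext
  funext k
  have hk := congrFun h k
  have hne : ((ρ : ℂ) ^ (-k : ℤ)) ≠ 0 := by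
    apply zpow_ne_zero
    exact_mod_cast (ne_of_gt hρ.out)
  exact smul_right_injective H hne (by simpa [wt] using hk)

noncomputable instance [Fact (1 ≤ p)] [Fact (0 < ρ)] : NormedAddCommGroup (WLp H p ρ) :=
  NormedAddCommGroup.induced _ _ ((toLpₗ H p ρ).toAddMonoidHom) (toLp_injective H p ρ)

noncomputable instance [Fact (1 ≤ p)] [Fact (0 < ρ)] : NormedSpace ℂ (WLp H p ρ) :=
  NormedSpace.induced ℂ _ _ (toLpₗ H p ρ)

end WLp

theorem Memℓp.comp_equiv {α β E : Type*} [NormedAddCommGroup E] {p : ℝ≥0∞} {f : β → E}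
    (hf : Memℓp f p) (e : α ≃ β) : Memℓp (f ∘ e) p := by
  rcases p.trichotomy with rfl | rfl | hp
  · rw [memℓp_zero_iff] at hf ⊢
    exact hf.preimage e.injective.injOn
  · rw [memℓp_infty_iff] at hf ⊢
    exact hf.mono (Set.range_comp_subset_range e fun i => ‖f i‖)
  · rw [memℓp_gen_iff hp] at hf ⊢
    exact e.summable_iff.mpr hf

theorem lp.norm_comp_equiv {α β E : Type*} [NormedAddCommGroup E] {p : ℝ≥0∞} [hp : Fact (1 ≤ p)]
    (f : lp (fun _ : β => E) p) (e : α ≃ β) :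
    ‖(⟨f ∘ e, (lp.memℓp f).comp_equiv e⟩ : lp (fun _ : α => E) p)‖ = ‖f‖ := by
  rcases p.trichotomy with rfl | rfl | h
  · exact absurd hp.out (by simp)
  · rw [lp.norm_eq_ciSup, lp.norm_eq_ciSup]
    exact e.iSup_comp (g := fun i => ‖f i‖)
  · rw [lp.norm_eq_tsum_rpow h, lp.norm_eq_tsum_rpow h]
    exact congrArg (· ^ (1 / p.toReal)) (e.tsum_eq fun i => ‖f i‖ ^ p.toReal)

namespace WLp

variable {H} {p : ℝ≥0∞} {ρ : ℝ}

theorem norm_eq_norm_toLpₗ [Fact (1 ≤ p)] [Fact (0 < ρ)] (x : WLp H p ρ) :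
    ‖x‖ = ‖toLpₗ H p ρ x‖ := rfl

theorem isometry_toLpₗ [Fact (1 ≤ p)] [Fact (0 < ρ)] : Isometry (toLpₗ H p ρ) :=
  AddMonoidHomClass.isometry_of_norm _ fun _ => rfl

theorem toLpₗ_surjective [hρ : Fact (0 < ρ)] : Function.Surjective (toLpₗ H p ρ) := by
  intro y
  have h : wt H ρ (fun k => (ρ : ℂ) ^ k • y k) = y := by
    funext k
    have hne : (ρ : ℂ) ^ k ≠ 0 := zpow_ne_zero _ (by exact_mod_cast hρ.out.ne')
    simp [wt, smul_smul, inv_mul_cancel₀ hne]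
  exact ⟨mk _ (h.symm ▸ lp.memℓp y), Subtype.ext h⟩

instance [Fact (1 ≤ p)] [Fact (0 < ρ)] [CompleteSpace H] : CompleteSpace (WLp H p ρ) := by
  rw [completeSpace_iff_isComplete_range isometry_toLpₗ.isUniformInducing,
    toLpₗ_surjective.range_eq]
  exact isComplete_univ

theorem wt_shift [hρ : Fact (0 < ρ)] (x : ℤ → H) :
    wt H ρ (fun k => x (k - 1)) = (ρ : ℂ)⁻¹ • (wt H ρ x ∘ Equiv.subRight (1 : ℤ)) := by
  funext k
  have hne : (ρ : ℂ) ≠ 0 := by exact_mod_cast hρ.out.ne'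
  have h : (ρ : ℂ) ^ (-k) = (ρ : ℂ)⁻¹ * (ρ : ℂ) ^ (-(k - 1)) := by
    rw [← zpow_neg_one, ← zpow_add₀ hne]
    congr 1
    ring
  simp only [wt, Pi.smul_apply, Function.comp_apply, Equiv.subRight_apply, smul_smul, h]

/-- The inverse `τ⁻¹` of the shift operator on `ℓ_{p,ρ}(ℤ; H)`. -/
def invShift [Fact (0 < ρ)] (x : WLp H p ρ) : WLp H p ρ :=
  mk (fun k => x (k - 1)) (by
    rw [wt_shift]
    exact (x.memℓp.comp_equiv _).const_smul _)

theorem invShift_apply [Fact (0 < ρ)] (x : WLp H p ρ) (k : ℤ) : invShift x k = x (k - 1) := rfl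

theorem invShift_sub [Fact (0 < ρ)] (x y : WLp H p ρ) :
    invShift (x - y) = invShift x - invShift y := rfl

theorem norm_invShift [Fact (1 ≤ p)] [hρ : Fact (0 < ρ)] (x : WLp H p ρ) :
    ‖invShift x‖ = ρ⁻¹ * ‖x‖ := by
  have h : toLpₗ H p ρ (invShift x) = (ρ : ℂ)⁻¹ •
      (⟨wt H ρ x ∘ Equiv.subRight (1 : ℤ), x.memℓp.comp_equiv _⟩ : lp (fun _ : ℤ => H) p) :=
    Subtype.ext (wt_shift _)
  have hx := lp.norm_comp_equiv (toLpₗ H p ρ x) (Equiv.subRight (1 : ℤ))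
  rw [norm_eq_norm_toLpₗ, h, norm_smul, norm_eq_norm_toLpₗ x, ← hx, norm_inv, Complex.norm_real,
    Real.norm_of_nonneg hρ.out.le]
  rfl

theorem dist_invShift [Fact (1 ≤ p)] [Fact (0 < ρ)] (x y : WLp H p ρ) :
    dist (invShift x) (invShift y) = ρ⁻¹ * dist x y := by
  rw [dist_eq_norm, dist_eq_norm, ← invShift_sub, norm_invShift]

theorem shift_eq_iff_invShift_eq [Fact (0 < ρ)] (u v : WLp H p ρ) :
    (∀ k : ℤ, u (k + 1) = v k) ↔ invShift v = u := by
  constructor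
  · intro h
    refine ext fun k => ?_
    rw [invShift_apply, ← h, sub_add_cancel]
  · rintro rfl k
    rw [invShift_apply, add_sub_cancel_right]

theorem contractingWith_invShift_comp [Fact (1 ≤ p)] [hρ : Fact (0 < ρ)]
    {F : WLp H p ρ → WLp H p ρ} {K : ℝ≥0} (hK : (K : ℝ) < ρ) (hF : LipschitzWith K F) :
    ContractingWith (ρ.toNNReal⁻¹ * K) (fun u => invShift (F u)) := by
  have hcoe : ((ρ.toNNReal⁻¹ * K : ℝ≥0) : ℝ) = ρ⁻¹ * K := by
    simp [Real.coe_toNNReal _ hρ.out.le]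
  refine ⟨?_, LipschitzWith.of_dist_le_mul fun x y => ?_⟩
  · rw [← NNReal.coe_lt_one, hcoe, inv_mul_lt_one₀ hρ.out]
    exact hK
  · rw [hcoe, dist_invShift, mul_assoc]
    exact mul_le_mul_of_nonneg_left (hF.dist_le_mul x y) (inv_nonneg.mpr hρ.out.le)

end WLp

/-- Existence and uniqueness of solutions.
Let `1 ≤ p ≤ ∞`, `ρ > 0`, and let `F : ℓ_{p,ρ}(ℤ;H) → ℓ_{p,ρ}(ℤ;H)` be Lipschitz with
Lipschitz constant `< ρ`.  Then the difference equation `τ u = F(u)` has a unique solution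
`u ∈ ℓ_{p,ρ}(ℤ;H)`. -/
theorem difference_equation_unique_solution
    (H : Type*) [NormedAddCommGroup H] [InnerProductSpace ℂ H] [CompleteSpace H]
    [TopologicalSpace.SeparableSpace H]
    (p : ℝ≥0∞) [Fact (1 ≤ p)] (ρ : ℝ) [Fact (0 < ρ)]
    (F : WLp H p ρ → WLp H p ρ)
    (K : ℝ≥0) (hK : (K : ℝ) < ρ) (hF : LipschitzWith K F) :
    ∃! u : WLp H p ρ, ∀ k : ℤ, u (k + 1) = (F u) k := by
  have hG := WLp.contractingWith_invShift_comp hK hF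
  simp only [WLp.shift_eq_iff_invShift_eq]
  exact ⟨ContractingWith.fixedPoint _ hG, hG.fixedPoint_isFixedPt,
    fun _ hv => hG.fixedPoint_unique hv⟩

end
end

section
/- Let ρ > 0 and let (ψ_n)_{n∈ℤ} be an orthonormal basis of H. The 𝒵 transform 𝒵_ρ : ℓ_{2,ρ}(ℤ;H) → L₂(S_ρ;H), x ↦ Σ_{k,n∈ℤ} ⟨ψ_n, ρ^{−k} x_k⟩_H p_{k,n}, is a well-defined unitary operator, and for every x ∈ ℓ_{1,ρ}(ℤ;H) ⊆ ℓ_{2,ρ}(ℤ;H) it is given pointwise by (𝒵_ρ x)(z) = Σ_{k∈ℤ} x_k z^{−k} for z ∈ S_ρ. -/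
open scoped ENNReal NNReal Real
open MeasureTheory
open Function

noncomputable section

variable (H : Type*) [NormedAddCommGroup H] [InnerProductSpace ℂ H]

variable {H}

variable (H)

/-- The normalized arc-length measure `dz/(2π|z|)` on the circle `S_ρ = {z : |z| = ρ}` in `ℂ`,
realized as the pushforward of normalized Lebesgue measure on `(-π, π]` under
`φ ↦ ρ e^{iφ}`.  Integrating against it realizes `(1/2π) ∫_{S_ρ} … dz/|z|`. -/
def circleMeasure (ρ : ℝ) : Measure ℂ :=
  Measure.map (fun φ : ℝ => (ρ : ℂ) * Complex.exp (φ * Complex.I))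
    ((ENNReal.ofReal (2 * π))⁻¹ • volume.restrict (Set.Ioc (-π) π))

/-- The parametrization `φ ↦ ρ e^{iφ}` of the circle of radius `ρ`. -/
def circleParam (ρ : ℝ) (φ : ℝ) : ℂ := (ρ : ℂ) * Complex.exp (φ * Complex.I)

theorem measurable_circleParam (ρ : ℝ) : Measurable (circleParam ρ) := by
  unfold circleParam
  fun_prop

/-- The normalized Lebesgue measure on `(-π, π]`. -/
def angleMeasure : Measure ℝ := (ENNReal.ofReal (2 * π))⁻¹ • volume.restrict (Set.Ioc (-π) π)

theorem circleMeasure_eq_map (ρ : ℝ) :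
    circleMeasure ρ = Measure.map (circleParam ρ) angleMeasure := rfl

instance : IsProbabilityMeasure angleMeasure := by
  constructor
  have h : (0 : ℝ) < 2 * π := by positivity
  rw [angleMeasure, Measure.smul_apply, Measure.restrict_apply_univ, Real.volume_Ioc, smul_eq_mul,
    show π - -π = 2 * π by ring]
  exact ENNReal.inv_mul_cancel (by simpa using h) ENNReal.ofReal_ne_top

instance (ρ : ℝ) : IsProbabilityMeasure (circleMeasure ρ) := by
  rw [circleMeasure_eq_map]
  exact Measure.isProbabilityMeasure_map (measurable_circleParam ρ).aemeasurable

theorem restrict_Ioc_eq_smul_angleMeasure :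
    volume.restrict (Set.Ioc (-π) π) = ENNReal.ofReal (2 * π) • angleMeasure := by
  have h : (0 : ℝ) < 2 * π := by positivity
  rw [angleMeasure, smul_smul, ENNReal.mul_inv_cancel (by simpa using h) ENNReal.ofReal_ne_top,
    one_smul]

theorem integral_circleMeasure {E : Type*} [NormedAddCommGroup E] [NormedSpace ℝ E] {ρ : ℝ}
    {f : ℂ → E} (hf : AEStronglyMeasurable f (circleMeasure ρ)) :
    ∫ z, f z ∂circleMeasure ρ = (2 * π)⁻¹ • ∫ φ in (-π)..π, f (circleParam ρ φ) := by
  rw [circleMeasure_eq_map] at hf ⊢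
  rw [integral_map (measurable_circleParam ρ).aemeasurable hf,
    intervalIntegral.integral_of_le (by linarith [Real.pi_pos]), angleMeasure,
    integral_smul_measure, ENNReal.toReal_inv, ENNReal.toReal_ofReal (by positivity)]

theorem ae_norm_eq_circleMeasure {ρ : ℝ} (hρ : 0 ≤ ρ) : ∀ᵐ z ∂circleMeasure ρ, ‖z‖ = ρ := by
  rw [circleMeasure_eq_map, ae_map_iff (measurable_circleParam ρ).aemeasurable
    (measurableSet_eq_fun measurable_norm measurable_const)]
  refine .of_forall fun φ => ?_
  simp [circleParam, Complex.norm_exp_ofReal_mul_I, abs_of_nonneg hρ]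

/-- The function `z ↦ ρ^k z^{-k}`, unimodular on the circle of radius `ρ`. -/
def circleMonomial (ρ : ℝ) (k : ℤ) (z : ℂ) : ℂ := (ρ : ℂ) ^ k * z ^ (-k)

theorem measurable_circleMonomial (ρ : ℝ) (k : ℤ) : Measurable (circleMonomial ρ k) := by
  unfold circleMonomial
  fun_prop

theorem circleMonomial_circleParam {ρ : ℝ} (hρ : 0 < ρ) (k : ℤ) (φ : ℝ) :
    circleMonomial ρ k (circleParam ρ φ) = Complex.exp (-k * Complex.I * φ) := by
  have h : (ρ : ℂ) ≠ 0 := by exact_mod_cast hρ.ne'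
  rw [circleMonomial, circleParam, mul_zpow, ← mul_assoc, ← zpow_add₀ h, add_neg_cancel, zpow_zero,
    one_mul, ← Complex.exp_int_mul]
  congr 1
  push_cast
  ring

theorem ae_norm_circleMonomial {ρ : ℝ} (hρ : 0 < ρ) (k : ℤ) :
    ∀ᵐ z ∂circleMeasure ρ, ‖circleMonomial ρ k z‖ = 1 := by
  filter_upwards [ae_norm_eq_circleMeasure hρ.le] with z hz
  rw [circleMonomial, norm_mul, norm_zpow, norm_zpow, hz, Complex.norm_real, Real.norm_eq_abs,
    abs_of_pos hρ, ← zpow_add₀ hρ.ne', add_neg_cancel, zpow_zero]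

theorem integral_conj_circleMonomial_mul {ρ : ℝ} (hρ : 0 < ρ) {j k : ℤ} (hjk : j ≠ k) :
    ∫ z, (starRingEnd ℂ) (circleMonomial ρ j z) * circleMonomial ρ k z ∂circleMeasure ρ = 0 := by
  rw [integral_circleMeasure]
  · have hc : ((j - k : ℤ) : ℂ) * Complex.I ≠ 0 :=
      mul_ne_zero (by exact_mod_cast sub_ne_zero.2 hjk) Complex.I_ne_zero
    have h : ∀ φ : ℝ, (starRingEnd ℂ) (circleMonomial ρ j (circleParam ρ φ)) *
        circleMonomial ρ k (circleParam ρ φ) =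
          Complex.exp (((j - k : ℤ) : ℂ) * Complex.I * φ) := by
      intro φ
      rw [circleMonomial_circleParam hρ, circleMonomial_circleParam hρ, ← Complex.exp_conj,
        ← Complex.exp_add]
      congr 1
      simp
      ring
    simp_rw [h]
    rw [integral_exp_mul_complex hc]
    have hper : Complex.exp (((j - k : ℤ) : ℂ) * Complex.I * (π : ℝ)) =
        Complex.exp (((j - k : ℤ) : ℂ) * Complex.I * (-π : ℝ)) := by
      rw [Complex.exp_eq_exp_iff_exists_int]
      refine ⟨j - k, ?_⟩
      push_cast
      ring
    rw [hper]
    simp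
  · exact ((Complex.continuous_conj.measurable.comp (measurable_circleMonomial ρ j)).mul
      (measurable_circleMonomial ρ k)).aestronglyMeasurable

/-- A square-integrable function on the circle all of whose Fourier coefficients vanish is zero. -/
theorem ae_eq_zero_of_integral_conj_circleMonomial_mul_eq_zero {ρ : ℝ} (hρ : 0 < ρ) {g : ℂ → ℂ}
    (hg : MemLp g 2 (circleMeasure ρ))
    (h : ∀ k, ∫ z, (starRingEnd ℂ) (circleMonomial ρ k z) * g z ∂circleMeasure ρ = 0) :
    g =ᵐ[circleMeasure ρ] 0 := by
  have hab : -π < π := by linarith [Real.pi_pos]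
  have hL2 : MemLp (g ∘ circleParam ρ) 2 (volume.restrict (Set.Ioc (-π) π)) := by
    rw [restrict_Ioc_eq_smul_angleMeasure]
    exact (hg.comp_of_map (measurable_circleParam ρ).aemeasurable).smul_measure
      ENNReal.ofReal_ne_top
  have hcoeff : ∀ n, fourierCoeffOn hab (g ∘ circleParam ρ) n = 0 := by
    intro n
    have hn := h (-n)
    rw [integral_circleMeasure, smul_eq_zero_iff_right (by positivity)] at hn
    · rw [fourierCoeffOn_eq_integral, ← smul_zero (1 / (π - -π)), ← hn]
      congr 1
      refine intervalIntegral.integral_congr fun φ _ => ?_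
      simp only [Function.comp_apply, smul_eq_mul, fourier_coe_apply]
      rw [circleMonomial_circleParam hρ, ← Complex.exp_conj]
      congr 2
      simp
      field_simp
      ring
    · exact (Complex.continuous_conj.measurable.comp
        (measurable_circleMonomial ρ _)).aestronglyMeasurable.mul hg.1
  have hsum := tsum_sq_fourierCoeffOn hab hL2
  simp only [hcoeff, norm_zero, ne_eq, OfNat.ofNat_ne_zero, not_false_eq_true, zero_pow,
    tsum_zero] at hsum
  have hint : ∫ z, ‖g z‖ ^ 2 ∂circleMeasure ρ = 0 := by
    rw [integral_circleMeasure (f := fun z => ‖g z‖ ^ 2) (hg.1.norm.pow 2), smul_eq_zero_iff_right (by positivity)]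
    have hne : (π - -π)⁻¹ ≠ 0 := inv_ne_zero (by linarith [Real.pi_pos])
    exact (smul_eq_zero_iff_right hne).1 hsum.symm
  rw [integral_eq_zero_iff_of_nonneg (fun z => by positivity) hg.norm.integrable_sq] at hint
  filter_upwards [hint] with z hz
  simpa using hz

section MonomialIsometry

variable {E : Type*} [NormedAddCommGroup E] [InnerProductSpace ℂ E] {ρ : ℝ}

theorem ae_norm_circleMonomial_smul (hρ : 0 < ρ) (k : ℤ) (v : E) :
    ∀ᵐ z ∂circleMeasure ρ, ‖circleMonomial ρ k z • v‖ = ‖v‖ := by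
  filter_upwards [ae_norm_circleMonomial hρ k] with z hz
  rw [norm_smul, hz, one_mul]

theorem memLp_circleMonomial_smul (hρ : 0 < ρ) (k : ℤ) (v : E) :
    MemLp (fun z => circleMonomial ρ k z • v) 2 (circleMeasure ρ) :=
  (memLp_const v).congr_norm
    ((measurable_circleMonomial ρ k).aestronglyMeasurable.smul aestronglyMeasurable_const)
    ((ae_norm_circleMonomial_smul hρ k v).mono fun _ hz => hz.symm)

/-- The isometric embedding `v ↦ (z ↦ ρ^k z^{-k} v)` of a Hilbert space into the
square-integrable functions on the circle. -/
def circleMonomialₗᵢ (E : Type*) [NormedAddCommGroup E] [InnerProductSpace ℂ E]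
    (hρ : 0 < ρ) (k : ℤ) : E →ₗᵢ[ℂ] Lp E 2 (circleMeasure ρ) where
  toFun v := (memLp_circleMonomial_smul hρ k v).toLp _
  map_add' v w := by
    rw [← MemLp.toLp_add]
    exact MemLp.toLp_congr _ _ (.of_forall fun z => smul_add _ _ _)
  map_smul' c v := by
    rw [RingHom.id_apply, ← MemLp.toLp_const_smul]
    exact MemLp.toLp_congr _ _ (.of_forall fun z => smul_comm _ _ _)
  norm_map' v := by
    change ‖(memLp_circleMonomial_smul hρ k v).toLp _‖ = ‖v‖
    rw [Lp.norm_toLp, eLpNorm_congr_norm_ae (ae_norm_circleMonomial_smul hρ k v),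
      eLpNorm_const _ two_ne_zero (IsProbabilityMeasure.ne_zero _)]
    simp

theorem coeFn_circleMonomialₗᵢ (hρ : 0 < ρ) (k : ℤ) (v : E) :
    circleMonomialₗᵢ E hρ k v =ᵐ[circleMeasure ρ] fun z => circleMonomial ρ k z • v :=
  (memLp_circleMonomial_smul hρ k v).coeFn_toLp

theorem inner_circleMonomialₗᵢ_left (hρ : 0 < ρ) (k : ℤ) (v : E) (f : Lp E 2 (circleMeasure ρ)) :
    inner ℂ (circleMonomialₗᵢ E hρ k v) f =
      ∫ z, (starRingEnd ℂ) (circleMonomial ρ k z) * inner ℂ v (f z) ∂circleMeasure ρ := by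
  rw [L2.inner_def]
  refine integral_congr_ae ?_
  filter_upwards [coeFn_circleMonomialₗᵢ hρ k v] with z hz
  rw [hz, inner_smul_left]

theorem orthogonalFamily_circleMonomialₗᵢ (hρ : 0 < ρ) :
    OrthogonalFamily ℂ (fun _ : ℤ => E) (circleMonomialₗᵢ E hρ) := by
  intro j k hjk v w
  rw [inner_circleMonomialₗᵢ_left]
  calc
    _ = ∫ z, (starRingEnd ℂ) (circleMonomial ρ j z) * circleMonomial ρ k z * inner ℂ v w
          ∂circleMeasure ρ := by
      refine integral_congr_ae ?_
      filter_upwards [coeFn_circleMonomialₗᵢ hρ k w] with z hz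
      rw [hz, inner_smul_right, mul_assoc]
    _ = 0 := by rw [integral_mul_const, integral_conj_circleMonomial_mul hρ hjk, zero_mul]

theorem isHilbertSum_circleMonomialₗᵢ [CompleteSpace E] {ι : Type*} [Countable ι]
    (ψ : HilbertBasis ι ℂ E) (hρ : 0 < ρ) :
    IsHilbertSum ℂ (fun _ : ℤ => E) (circleMonomialₗᵢ E hρ) := by
  refine IsHilbertSum.mk (orthogonalFamily_circleMonomialₗᵢ hρ) (top_le_iff.2 ?_)
  rw [Submodule.topologicalClosure_eq_top_iff, Submodule.eq_bot_iff]
  intro f hf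
  have hcoord : ∀ n, (fun z => inner ℂ (ψ n) (f z)) =ᵐ[circleMeasure ρ] 0 := by
    intro n
    refine ae_eq_zero_of_integral_conj_circleMonomial_mul_eq_zero hρ
      ((Lp.memLp f).const_inner (ψ n)) fun k => ?_
    rw [← inner_circleMonomialₗᵢ_left hρ]
    exact (Submodule.mem_orthogonal _ _).1 hf _
      (Submodule.mem_iSup_of_mem k (LinearMap.mem_range_self _ _))
  refine (Lp.eq_zero_iff_ae_eq_zero).2 ?_
  filter_upwards [ae_all_iff.2 hcoord] with z hz
  apply ψ.repr.injective
  ext n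
  simpa [ψ.repr_apply_apply] using hz n

end MonomialIsometry

/-- The weighting map as an isometric isomorphism onto the unweighted space. -/
def WLp.toLpₗᵢ (E : Type*) [NormedAddCommGroup E] [InnerProductSpace ℂ E] (p : ℝ≥0∞)
    [Fact (1 ≤ p)] (ρ : ℝ) [hρ : Fact (0 < ρ)] :
    WLp E p ρ ≃ₗᵢ[ℂ] lp (fun _ : ℤ => E) p :=
  LinearIsometryEquiv.ofSurjective (σ₁₂ := RingHom.id ℂ) ⟨WLp.toLpₗ E p ρ, fun _ => rfl⟩ (by
    intro y
    have h : (ρ : ℂ) ≠ 0 := by exact_mod_cast hρ.out.ne'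
    have hy : wt E ρ (fun k => (ρ : ℂ) ^ k • y k) = y := by
      funext k
      rw [wt, smul_smul, ← zpow_add₀ h, neg_add_cancel, zpow_zero, one_smul]
    exact ⟨WLp.mk (fun k => (ρ : ℂ) ^ k • y k) (by rw [hy]; exact lp.memℓp y), Subtype.ext hy⟩)

theorem WLp.toLpₗᵢ_apply {E : Type*} [NormedAddCommGroup E] [InnerProductSpace ℂ E] {p : ℝ≥0∞}
    [Fact (1 ≤ p)] {ρ : ℝ} [Fact (0 < ρ)] (x : WLp E p ρ) (k : ℤ) :
    WLp.toLpₗᵢ E p ρ x k = (ρ : ℂ) ^ (-k) • x k := rfl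

/-- The `𝒵` transform.
Let `ρ > 0`.  The `𝒵` transform is a well-defined unitary operator
`𝒵_ρ : ℓ_{2,ρ}(ℤ;H) → L₂(S_ρ;H)` which, for every `x ∈ ℓ_{1,ρ}(ℤ;H) ⊆ ℓ_{2,ρ}(ℤ;H)`,
is given pointwise by `(𝒵_ρ x)(z) = Σ_{k∈ℤ} x_k z^{-k}` for `z ∈ S_ρ`. -/
theorem z_transform_unitary
    (H : Type*) [NormedAddCommGroup H] [InnerProductSpace ℂ H] [CompleteSpace H]
    (ψ : HilbertBasis ℤ ℂ H)
    (ρ : ℝ) [Fact (0 < ρ)] :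
    ∃ Z : WLp H 2 ρ ≃ₗᵢ[ℂ] Lp H 2 (circleMeasure ρ),
      ∀ x : WLp H 2 ρ,
        Summable (fun k : ℤ => ‖x k‖ * ρ ^ (-k : ℤ)) →
          (Z x : ℂ → H) =ᵐ[circleMeasure ρ] fun z => ∑' k : ℤ, (z ^ (-k : ℤ)) • x k := by
  have hρ : 0 < ρ := Fact.out
  have hρc : (ρ : ℂ) ≠ 0 := by exact_mod_cast hρ.ne'
  have hV := isHilbertSum_circleMonomialₗᵢ ψ hρ
  refine ⟨(WLp.toLpₗᵢ H 2 ρ).trans hV.linearIsometryEquiv.symm, fun x hx => ?_⟩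
  rw [LinearIsometryEquiv.trans_apply, hV.linearIsometryEquiv_symm_apply]
  have hsum : ∑' k, ‖circleMonomialₗᵢ H hρ k (WLp.toLpₗᵢ H 2 ρ x k)‖ₑ ≠ ∞ := by
    refine tsum_enorm_ne_top_iff_summable_norm.2 (hx.congr fun k => ?_)
    rw [LinearIsometry.norm_map, WLp.toLpₗᵢ_apply, norm_smul, norm_zpow, Complex.norm_real,
      Real.norm_of_nonneg hρ.le, mul_comm]
  filter_upwards [Lp.coeFn_tsum hsum, ae_all_iff.2 fun k =>
    coeFn_circleMonomialₗᵢ hρ k (WLp.toLpₗᵢ H 2 ρ x k)] with z hz hmon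
  rw [hz]
  refine tsum_congr fun k => ?_
  rw [hmon k, WLp.toLpₗᵢ_apply, smul_smul, circleMonomial, mul_right_comm, ← zpow_add₀ hρc,
    add_neg_cancel, zpow_zero, one_mul]

end
end
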